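/- arXiv:2401.00086 — 4 statements merged into one kernel-verified Lean document; each statement's English description precedes it below -/
import Mathlib

section
/- Let G be a digraph, U₁ ⊆ V(G), u ∈ V(G) \ U₁, and U₂ = U₁ ∪ {u}. Suppose u ≡_{G[U₂]} v for some v ∈ U₁. Then for every x, y ∈ U₁, x ≡_{G[U₁]} y implies x ≡_{G[U₂]} y. -/
/-- An edge-labelled directed graph over vertex type `V` with labels (access rights) `A`:
a vertex set, an edge set `E ⊆ V(G) × Σ × V(G)`. -/
structure LDigraph (V A : Type*) where
  verts : Set V
  edges : Set (V × A × V)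
  edges_subset : ∀ e ∈ edges, e.1 ∈ verts ∧ e.2.2 ∈ verts

/-- The subgraph of `G` induced by a vertex set `U`. -/
def LDigraph.induce {V A : Type*} (G : LDigraph V A) (U : Set V) : LDigraph V A where
  verts := U
  edges := {e ∈ G.edges | e.1 ∈ U ∧ e.2.2 ∈ U}
  edges_subset := fun _ he => ⟨he.2.1, he.2.2⟩

/-- Vertices `u` and `v` of `G` are indistinguishable (`u ≡_G v`). -/
def Indist {V A : Type*} (G : LDigraph V A) (u v : V) : Prop :=
  ∀ a : A,
    (((u, a, u) ∈ G.edges ∧ (u, a, v) ∈ G.edges ∧ (v, a, u) ∈ G.edges ∧ (v, a, v) ∈ G.edges) ∨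
     ((u, a, u) ∉ G.edges ∧ (u, a, v) ∉ G.edges ∧ (v, a, u) ∉ G.edges ∧ (v, a, v) ∉ G.edges)) ∧
    ∀ x ∈ G.verts, x ≠ u → x ≠ v →
      (((u, a, x) ∈ G.edges ↔ (v, a, x) ∈ G.edges) ∧
       ((x, a, u) ∈ G.edges ↔ (x, a, v) ∈ G.edges))

/-- `π` is a strong homomorphism from `G` to `H`. -/
def StrongHom {V W A : Type*} (G : LDigraph V A) (H : LDigraph W A) (π : V → W) : Prop :=
  Set.MapsTo π G.verts H.verts ∧
  ∀ u ∈ G.verts, ∀ v ∈ G.verts, ∀ a : A,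
    (u, a, v) ∈ G.edges ↔ (π u, a, π v) ∈ H.edges

/-- `H'` is a subgraph of `H`. -/
def IsSubgraph {W A : Type*} (H' H : LDigraph W A) : Prop :=
  H'.verts ⊆ H.verts ∧ H'.edges ⊆ H.edges

/-- `H` is a summary of `G`: `G` is strongly homomorphic to `H`, but not to any
proper subgraph of `H`. -/
def IsSummary {V W A : Type*} (G : LDigraph V A) (H : LDigraph W A) : Prop :=
  (∃ π : V → W, StrongHom G H π) ∧
  ∀ H' : LDigraph W A, IsSubgraph H' H → H' ≠ H → ¬ ∃ π : V → W, StrongHom G H' π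

/-- `H₁` and `H₂` are isomorphic digraphs. -/
def Isomorphic {V W A : Type*} (H₁ : LDigraph V A) (H₂ : LDigraph W A) : Prop :=
  ∃ f : V → W, Set.BijOn f H₁.verts H₂.verts ∧
    ∀ u ∈ H₁.verts, ∀ v ∈ H₁.verts, ∀ a : A,
      (u, a, v) ∈ H₁.edges ↔ (f u, a, f v) ∈ H₂.edges

/-- The error set `𝓔(G, H, π)` of a domain-based policy `(H, π)` for `G`:
all grant errors and deny errors among requests over `V(G) × Σ × V(G)`. -/
def ErrSet {V W A : Type*} (G : LDigraph V A) (H : LDigraph W A) (π : V → W) :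
    Set (V × A × V) :=
  {e | e.1 ∈ G.verts ∧ e.2.2 ∈ G.verts ∧
    (((π e.1, e.2.1, π e.2.2) ∈ H.edges ∧ e ∉ G.edges) ∨
     ((π e.1, e.2.1, π e.2.2) ∉ H.edges ∧ e ∈ G.edges))}

/-- Two vertices are indistinguishable iff they have the same out- and in-neighbours
along every label. -/
theorem indist_iff_forall_edges {V A : Type*} {G : LDigraph V A} {x y : V}
    (hx : x ∈ G.verts) (hy : y ∈ G.verts) :
    Indist G x y ↔ ∀ a : A, ∀ z ∈ G.verts,
      ((x, a, z) ∈ G.edges ↔ (y, a, z) ∈ G.edges) ∧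
      ((z, a, x) ∈ G.edges ↔ (z, a, y) ∈ G.edges) := by
  constructor
  · intro h a z hz
    obtain ⟨h₁, h₂⟩ := h a
    by_cases hzx : z = x
    · subst hzx; tauto
    by_cases hzy : z = y
    · subst hzy; tauto
    exact h₂ z hz hzx hzy
  · intro h a
    have hax := h a x hx
    have hay := h a y hy
    exact ⟨by tauto, fun z hz _ _ => h a z hz⟩

theorem LDigraph.mem_edges_induce {V A : Type*} {G : LDigraph V A} {U : Set V} {x y : V}
    {a : A} (hx : x ∈ U) (hy : y ∈ U) :
    (x, a, y) ∈ (G.induce U).edges ↔ (x, a, y) ∈ G.edges :=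
  ⟨fun h => h.1, fun h => ⟨h, hx, hy⟩⟩

theorem indist_induce_iff {V A : Type*} {G : LDigraph V A} {U : Set V} {x y : V}
    (hx : x ∈ U) (hy : y ∈ U) :
    Indist (G.induce U) x y ↔ ∀ a : A, ∀ z ∈ U,
      ((x, a, z) ∈ G.edges ↔ (y, a, z) ∈ G.edges) ∧
      ((z, a, x) ∈ G.edges ↔ (z, a, y) ∈ G.edges) := by
  rw [indist_iff_forall_edges (G := G.induce U) hx hy]
  refine forall_congr' fun a => forall₂_congr fun z (hz : z ∈ U) => ?_
  simp only [LDigraph.mem_edges_induce, hx, hy, hz]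

/-- Prop. 2: if the new vertex `u` is indistinguishable (in `G[U₁ ∪ {u}]`) from some
previously seen vertex `v`, then indistinguishable pairs in `G[U₁]` remain
indistinguishable in `G[U₁ ∪ {u}]`. -/
theorem indist_preserved_of_nonNovel {V A : Type*} (G : LDigraph V A)
    (U₁ : Set V) (hU₁ : U₁ ⊆ G.verts) (u : V) (hu : u ∈ G.verts) (huU : u ∉ U₁)
    (v : V) (hv : v ∈ U₁) (huv : Indist (G.induce (U₁ ∪ {u})) u v) :
    ∀ x ∈ U₁, ∀ y ∈ U₁,
      Indist (G.induce U₁) x y → Indist (G.induce (U₁ ∪ {u})) x y := by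
  intro x hx y hy hxy
  rw [indist_induce_iff (U := U₁ ∪ {u}) (Or.inr rfl) (Or.inl hv)] at huv
  rw [indist_induce_iff hx hy] at hxy
  rw [indist_induce_iff (U := U₁ ∪ {u}) (Or.inl hx) (Or.inl hy)]
  rintro a z (hz | rfl)
  · exact hxy a z hz
  · have hux := huv a x (Or.inl hx)
    have huy := huv a y (Or.inl hy)
    have hvxy := hxy a v hv
    exact ⟨hux.2.trans (hvxy.1.trans huy.2.symm), hux.1.trans (hvxy.2.trans huy.1.symm)⟩
end

section
/- Let G be a digraph and r : V(G) → V(G) a function such that r(u) ≡_G u for every u ∈ V(G). Then r is a strong homomorphism from G to the subgraph of G induced by the range of r, i.e., for all u, v ∈ V(G) and a ∈ Σ, (u,a,v) ∈ E(G) iff (r(u), a, r(v)) ∈ E(G). -/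
theorem Indist.edge_left_iff {V A : Type*} {G : LDigraph V A} {u v : V} (h : Indist G u v)
    {x : V} (hx : x ∈ G.verts) (a : A) : (u, a, x) ∈ G.edges ↔ (v, a, x) ∈ G.edges := by
  obtain ⟨hloop, hout⟩ := h a
  by_cases hu : x = u
  · subst hu; tauto
  by_cases hv : x = v
  · subst hv; tauto
  exact (hout x hx hu hv).1

theorem Indist.edge_right_iff {V A : Type*} {G : LDigraph V A} {u v : V} (h : Indist G u v)
    {x : V} (hx : x ∈ G.verts) (a : A) : (x, a, u) ∈ G.edges ↔ (x, a, v) ∈ G.edges := by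
  obtain ⟨hloop, hin⟩ := h a
  by_cases hu : x = u
  · subst hu; tauto
  by_cases hv : x = v
  · subst hv; tauto
  exact (hin x hx hu hv).2

/-- A representative-choosing function `r` (with `r(u) ≡_G u` for all `u ∈ V(G)`) is a
strong homomorphism from `G` to the subgraph of `G` induced by the range of `r`:
`(u,a,v) ∈ E(G)` iff `(r(u),a,r(v)) ∈ E(G)`. -/
theorem representative_strongHom {V A : Type*} (G : LDigraph V A) (r : V → V)
    (hmem : ∀ u ∈ G.verts, r u ∈ G.verts)
    (hr : ∀ u ∈ G.verts, Indist G (r u) u) :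
    StrongHom G (G.induce (r '' G.verts)) r ∧
    ∀ u ∈ G.verts, ∀ v ∈ G.verts, ∀ a : A,
      (u, a, v) ∈ G.edges ↔ (r u, a, r v) ∈ G.edges := by
  have key : ∀ u ∈ G.verts, ∀ v ∈ G.verts, ∀ a : A,
      (u, a, v) ∈ G.edges ↔ (r u, a, r v) ∈ G.edges := fun u hu v hv a =>
    ((hr u hu).edge_left_iff hv a).symm.trans ((hr v hv).edge_right_iff (hmem u hu) a).symm
  refine ⟨⟨Set.mapsTo_image r G.verts, fun u hu v hv a => (key u hu v hv a).trans ?_⟩, key⟩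
  exact ⟨fun h => ⟨h, Set.mem_image_of_mem r hu, Set.mem_image_of_mem r hv⟩, fun h => h.1⟩
end

section
/- Let G be a finite digraph, H a summary of G, and π a strong homomorphism from G to H. Then for all u, v ∈ V(G), π(u) = π(v) if and only if u ≡_G v. -/
/-- Vertices are indistinguishable iff they have the same out- and in-neighbours for every
label. -/
theorem indist_iff_forall_mem {V A : Type*} {G : LDigraph V A} {u v : V}
    (hu : u ∈ G.verts) (hv : v ∈ G.verts) :
    Indist G u v ↔ ∀ a : A, ∀ x ∈ G.verts,
      ((u, a, x) ∈ G.edges ↔ (v, a, x) ∈ G.edges) ∧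
      ((x, a, u) ∈ G.edges ↔ (x, a, v) ∈ G.edges) := by
  refine forall_congr' fun a => ⟨fun ⟨h, hx⟩ x hxG => ?_, fun h => ⟨?_, fun x hx _ _ => h x hx⟩⟩
  · by_cases hxu : x = u
    · subst hxu; tauto
    by_cases hxv : x = v
    · subst hxv; tauto
    exact hx x hxG hxu hxv
  · have h₁ := h u hu
    have h₂ := h v hv
    tauto

/-- A strong homomorphism can be redirected from the fibre of `v` to the image of an
indistinguishable vertex `u`. -/
theorem StrongHom.exists_avoiding {V W A : Type*} {G : LDigraph V A} {H : LDigraph W A}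
    {π : V → W} (hπ : StrongHom G H π) {u v : V} (hu : u ∈ G.verts) (hv : v ∈ G.verts)
    (huv : Indist G u v) (hne : π u ≠ π v) :
    ∃ ρ : V → W, StrongHom G (H.induce (H.verts \ {π v})) ρ := by
  classical
  rw [indist_iff_forall_mem hu hv] at huv
  let f : V → V := fun w => if π w = π v then u else w
  have hfG : ∀ w ∈ G.verts, f w ∈ G.verts := fun w hw => by
    by_cases h : π w = π v <;> simp [f, h, hu, hw]
  have hfv : ∀ w, π (f w) ≠ π v := fun w => by
    by_cases h : π w = π v <;> simp [f, h, hne]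
  have hfE : ∀ w ∈ G.verts, ∀ x ∈ G.verts, ∀ a,
      ((w, a, x) ∈ G.edges ↔ (f w, a, x) ∈ G.edges) ∧
      ((x, a, w) ∈ G.edges ↔ (x, a, f w) ∈ G.edges) := fun w hw x hx a => by
    by_cases h : π w = π v
    · simp only [f, h, if_true]
      rw [(huv a x hx).1, (huv a x hx).2, hπ.2 w hw x hx, hπ.2 x hx w hw,
        hπ.2 v hv x hx, hπ.2 x hx v hv, h]
      exact ⟨Iff.rfl, Iff.rfl⟩
    · simp [f, h]
  have hmem : ∀ w ∈ G.verts, π (f w) ∈ H.verts \ {π v} :=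
    fun w hw => ⟨hπ.1 (hfG w hw), hfv w⟩
  refine ⟨π ∘ f, hmem, fun w hw x hx a => ?_⟩
  rw [(hfE w hw x hx a).1, (hfE x hx (f w) (hfG w hw) a).2,
    hπ.2 (f w) (hfG w hw) (f x) (hfG x hx)]
  exact ⟨fun h => ⟨h, hmem w hw, hmem x hx⟩, fun h => h.1⟩

/-- A strong homomorphism onto a summary of a finite digraph identifies exactly the
indistinguishable vertices. -/
theorem summary_strongHom_eq_iff_indist {V W A : Type*} (G : LDigraph V A)
    (hG : G.verts.Finite) (H : LDigraph W A) (hsum : IsSummary G H)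
    (π : V → W) (hπ : StrongHom G H π) :
    ∀ u ∈ G.verts, ∀ v ∈ G.verts, (π u = π v ↔ Indist G u v) := by
  intro u hu v hv
  constructor
  · intro h
    rw [indist_iff_forall_mem hu hv]
    intro a x hx
    rw [hπ.2 u hu x hx, hπ.2 x hx u hu, hπ.2 v hv x hx, hπ.2 x hx v hv, h]
    exact ⟨Iff.rfl, Iff.rfl⟩
  · intro h
    by_contra hne
    refine hsum.2 (H.induce (H.verts \ {π v})) ⟨Set.sdiff_subset, fun e he => he.1⟩ ?_
      (hπ.exists_avoiding hu hv h hne)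
    intro heq
    have hmem : π v ∈ (H.induce (H.verts \ {π v})).verts := heq.symm ▸ hπ.1 hv
    exact hmem.2 rfl
end

section
/- Let G be a digraph, U ⊆ V(G), u ∈ V(G) \ U, and U' = U ∪ {u}. Let H be a digraph and π : U → V(H) a strong homomorphism from G[U] to H. Suppose u ≡_{G[U']} v for some v ∈ U. Then the extended function π' = π[u ↦ π(v)] (which agrees with π on U and maps u to π(v)) is a strong homomorphism from G[U'] to H. -/
/-- Membership in the edge set of an induced subgraph, for endpoints in the inducing set. -/
theorem LDigraph.mem_induce_edges_iff {V A : Type*} (G : LDigraph V A) {U : Set V} {x y : V}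
    (hx : x ∈ U) (hy : y ∈ U) (a : A) :
    (x, a, y) ∈ (G.induce U).edges ↔ (x, a, y) ∈ G.edges :=
  ⟨fun h => h.1, fun h => ⟨h, hx, hy⟩⟩

/-- Replacing `u` by an indistinguishable vertex `v` in both endpoints preserves edges. -/
theorem Indist.edge_iff_update {V A : Type*} [DecidableEq V] {G : LDigraph V A} {u v : V}
    (h : Indist G u v) {x y : V} (hx : x ∈ G.verts) (hy : y ∈ G.verts) (a : A) :
    (x, a, y) ∈ G.edges ↔ (Function.update id u v x, a, Function.update id u v y) ∈ G.edges := by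
  obtain ⟨h₁, h₂⟩ := h a
  have hx₂ := h₂ x hx
  have hy₂ := h₂ y hy
  simp only [Function.update_apply, id]
  grind

/-- If the new vertex `u` is indistinguishable (in `G[U ∪ {u}]`) from some `v ∈ U`,
then extending the strong homomorphism `π : G[U] → H` by mapping `u` to `π(v)` yields
a strong homomorphism from `G[U ∪ {u}]` to `H`. -/
theorem extend_strongHom_of_indist {V W A : Type*} [DecidableEq V]
    (G : LDigraph V A) (H : LDigraph W A)
    (U : Set V) (hU : U ⊆ G.verts) (u : V) (hu : u ∈ G.verts) (huU : u ∉ U)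
    (π : V → W) (hπ : StrongHom (G.induce U) H π)
    (v : V) (hv : v ∈ U) (hind : Indist (G.induce (U ∪ {u})) u v) :
    StrongHom (G.induce (U ∪ {u})) H (Function.update π u (π v)) := by
  have hrU : ∀ x ∈ U ∪ {u}, Function.update id u v x ∈ U := by
    intro x hx
    rcases eq_or_ne x u with rfl | hxu
    · simpa using hv
    · simpa [hxu] using hx
  have hπr : ∀ x, Function.update π u (π v) x = π (Function.update id u v x) := by
    intro x
    simp only [Function.update_apply, id]
    split_ifs <;> rfl
  refine ⟨fun x hx => ?_, fun x hx y hy a => ?_⟩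
  · rw [hπr]
    exact hπ.1 (hrU x hx)
  · rw [hπr, hπr, ← hπ.2 _ (hrU x hx) _ (hrU y hy), hind.edge_iff_update hx hy,
      G.mem_induce_edges_iff (Or.inl (hrU x hx)) (Or.inl (hrU y hy)),
      G.mem_induce_edges_iff (hrU x hx) (hrU y hy)]
end
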